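/- arXiv:2312.16543 — 5 statements merged into one kernel-verified Lean document; each statement's English description precedes it below -/
import Mathlib

section
/- Let (J, ·) be a Jordan superalgebra and let α : J → J be an even superalgebra morphism (α(x·y) = α(x)·α(y)). Then the triple (J, ·_α, α), where the new product is defined on homogeneous elements by x ·_α y = α(x)·α(y), is a multiplicative Hom-Jordan superalgebra. -/
open scoped TensorProduct

noncomputable section

/-- The sign `(-1)^e` attached to a parity `e : ZMod 2`. -/
def gsign (K : Type*) [Field K] (e : ZMod 2) : K := (-1 : K) ^ e.val

variable {K : Type*} [Field K] [CharZero K]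
variable {J V : Type*} [AddCommGroup J] [Module K J] [AddCommGroup V] [Module K V]

/-- An even bilinear map with respect to a `ZMod 2`-grading. -/
def EvenBilin (g : ZMod 2 → Submodule K J) (m : J →ₗ[K] J →ₗ[K] J) : Prop :=
  ∀ i j : ZMod 2, ∀ x ∈ g i, ∀ y ∈ g j, m x y ∈ g (i + j)

/-- An even linear map with respect to a `ZMod 2`-grading. -/
def EvenMap (g : ZMod 2 → Submodule K J) (α : J →ₗ[K] J) : Prop :=
  ∀ i : ZMod 2, ∀ x ∈ g i, α x ∈ g i

/-- Super-commutativity `x·y = (-1)^{|x||y|} y·x` on homogeneous elements. -/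
def SuperComm (g : ZMod 2 → Submodule K J) (m : J →ₗ[K] J →ₗ[K] J) : Prop :=
  ∀ i j : ZMod 2, ∀ x ∈ g i, ∀ y ∈ g j, m x y = gsign K (i * j) • m y x

/-- The Hom-associator `as_α(x,y,z) = (x·y)·α(z) − α(x)·(y·z)`. -/
def hAss (m : J →ₗ[K] J →ₗ[K] J) (α : J →ₗ[K] J) (x y z : J) : J :=
  m (m x y) (α z) - m (α x) (m y z)

/-- The Hom-Jordan super-identity: the cyclic sum over `(x,y,u)` of
`(-1)^{|u|(|x|+|z|)} as_α(x·y, α(z), α(u))` vanishes. -/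
def HomJordanId (g : ZMod 2 → Submodule K J) (m : J →ₗ[K] J →ₗ[K] J) (α : J →ₗ[K] J) : Prop :=
  ∀ px py pz pu : ZMod 2, ∀ x ∈ g px, ∀ y ∈ g py, ∀ z ∈ g pz, ∀ u ∈ g pu,
      gsign K (pu * (px + pz)) • hAss m α (m x y) (α z) (α u)
    + gsign K (px * (py + pz)) • hAss m α (m y u) (α z) (α x)
    + gsign K (py * (pu + pz)) • hAss m α (m u x) (α z) (α y) = 0

/-- Hom-Jordan superalgebra. -/
def IsHomJordan (g : ZMod 2 → Submodule K J) (m : J →ₗ[K] J →ₗ[K] J) (α : J →ₗ[K] J) : Prop :=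
  EvenBilin g m ∧ EvenMap g α ∧ SuperComm g m ∧ HomJordanId g m α

/-- `α` is multiplicative with respect to `m`. -/
def IsMult (m : J →ₗ[K] J →ₗ[K] J) (α : J →ₗ[K] J) : Prop :=
  ∀ x y : J, α (m x y) = m (α x) (α y)

/-- Multiplicative Hom-Jordan superalgebra. -/
def IsMultHomJordan (g : ZMod 2 → Submodule K J) (m : J →ₗ[K] J →ₗ[K] J) (α : J →ₗ[K] J) :
    Prop :=
  IsHomJordan g m α ∧ IsMult m α

/-- Evenness of a representation map. -/
def EvenRepMap (g : ZMod 2 → Submodule K J) (gV : ZMod 2 → Submodule K V)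
    (π : J →ₗ[K] Module.End K V) : Prop :=
  ∀ i j : ZMod 2, ∀ x ∈ g i, ∀ v ∈ gV j, π x v ∈ gV (i + j)

/-- Representation (module) of a Hom-Jordan superalgebra. -/
def IsRep (g : ZMod 2 → Submodule K J) (m : J →ₗ[K] J →ₗ[K] J) (α : J →ₗ[K] J)
    (gV : ZMod 2 → Submodule K V) (π : J →ₗ[K] Module.End K V) (β : Module.End K V) : Prop :=
  EvenRepMap g gV π ∧ (∀ i : ZMod 2, ∀ v ∈ gV i, β v ∈ gV i) ∧
  (∀ x : J, β * π x = π (α x) * β) ∧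
  (∀ px py pz : ZMod 2, ∀ x ∈ g px, ∀ y ∈ g py, ∀ z ∈ g pz,
      gsign K (px * pz) • (π (m (α x) (α y)) * π (α z) * β)
    + gsign K (px * py) • (π (m (α y) (α z)) * π (α x) * β)
    + gsign K (py * pz) • (π (m (α z) (α x)) * π (α y) * β)
    = gsign K (px * pz) • (π (α (α x)) * π (m y z) * β)
    + gsign K (px * py) • (π (α (α y)) * π (m z x) * β)
    + gsign K (py * pz) • (π (α (α z)) * π (m x y) * β)) ∧
  (∀ px py pz : ZMod 2, ∀ x ∈ g px, ∀ y ∈ g py, ∀ z ∈ g pz,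
      gsign K (px * pz) • (π (m (α x) (α y)) * π (α z) * β)
    + gsign K (px * py) • (π (m (α y) (α z)) * π (α x) * β)
    + gsign K (py * pz) • (π (m (α z) (α x)) * π (α y) * β)
    = gsign K (px * pz) • (π (α (α x)) * π (α y) * π z)
    + gsign K (px * py + py * pz) • (π (α (α z)) * π (α y) * π x)
    + gsign K (py * pz + px * pz) • (π (m (m x z) (α y)) * (β * β)))

/-- O-operator on `J` associated to the representation `(V, π, β)`. -/
def IsOOperator (g : ZMod 2 → Submodule K J) (m : J →ₗ[K] J →ₗ[K] J) (α : J →ₗ[K] J)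
    (gV : ZMod 2 → Submodule K V) (π : J →ₗ[K] Module.End K V) (β : Module.End K V)
    (T : V →ₗ[K] J) : Prop :=
  (∀ i : ZMod 2, ∀ v ∈ gV i, T v ∈ g i) ∧
  (∀ v : V, α (T v) = T (β v)) ∧
  (∀ i j : ZMod 2, ∀ u ∈ gV i, ∀ v ∈ gV j,
    m (T u) (T v) = T (π (T u) v + gsign K (i * j) • π (T v) u))

/-- The grading on a direct sum `J ⊕ V`. -/
def prodGrading (g : ZMod 2 → Submodule K J) (gV : ZMod 2 → Submodule K V) :
    ZMod 2 → Submodule K (J × V) := fun i => (g i).prod (gV i)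

/-- The semidirect product multiplication, determined on homogeneous elements. -/
def IsSemidirectMul (g : ZMod 2 → Submodule K J) (gV : ZMod 2 → Submodule K V)
    (m : J →ₗ[K] J →ₗ[K] J) (π : J →ₗ[K] Module.End K V)
    (m' : (J × V) →ₗ[K] (J × V) →ₗ[K] (J × V)) : Prop :=
  ∀ i j : ZMod 2, ∀ x ∈ g i, ∀ u ∈ gV i, ∀ y ∈ g j, ∀ v ∈ gV j,
    m' (x, u) (y, v) = (m x y, π x v + gsign K (i * j) • π y u)

/-- The induced grading on the linear dual. -/
def dualGrading (gV : ZMod 2 → Submodule K V) (i : ZMod 2) :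
    Submodule K (Module.Dual K V) where
  carrier := {ξ | ∀ x ∈ gV (i + 1), ξ x = 0}
  add_mem' := by
    intro a b ha hb x hx
    simp [ha x hx, hb x hx]
  zero_mem' := by
    intro x hx
    simp
  smul_mem' := by
    intro c a ha x hx
    simp [ha x hx]

/-- Nijenhuis operator on a Hom-Jordan superalgebra. -/
def IsNijenhuis (gA : ZMod 2 → Submodule K J) (mA : J →ₗ[K] J →ₗ[K] J)
    (γ N : J →ₗ[K] J) : Prop :=
  EvenMap gA N ∧ N ∘ₗ γ = γ ∘ₗ N ∧
  ∀ x y : J, mA (N x) (N y) = N (mA (N x) y + mA x (N y) - N (mA x y))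

/-- The super-symmetrized product `x·y = x∘y + (-1)^{|x||y|} y∘x` on homogeneous
elements of parities `i`, `j`. -/
def sMul (c : J →ₗ[K] J →ₗ[K] J) (i j : ZMod 2) (x y : J) : J :=
  c x y + gsign K (i * j) • c y x

/-- Hom-pre-Jordan superalgebra. -/
def IsHomPreJordan (g : ZMod 2 → Submodule K J) (c : J →ₗ[K] J →ₗ[K] J) (α : J →ₗ[K] J) :
    Prop :=
  EvenBilin g c ∧ EvenMap g α ∧ IsMult c α ∧
  (∀ px py pz pu : ZMod 2, ∀ x ∈ g px, ∀ y ∈ g py, ∀ z ∈ g pz, ∀ u ∈ g pu,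
      c (sMul c px py (α x) (α y)) (c (α z) (α u))
    + gsign K (px * (py + pz)) • c (sMul c py pz (α y) (α z)) (c (α x) (α u))
    + gsign K (pz * (px + py)) • c (sMul c pz px (α z) (α x)) (c (α y) (α u))
    = c (α (α x)) (c (sMul c py pz y z) (α u))
    + gsign K (px * (py + pz)) • c (α (α y)) (c (sMul c pz px z x) (α u))
    + gsign K (pz * (px + py)) • c (α (α z)) (c (sMul c px py x y) (α u))) ∧
  (∀ px py pz pu : ZMod 2, ∀ x ∈ g px, ∀ y ∈ g py, ∀ z ∈ g pz, ∀ u ∈ g pu,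
      c (α (α x)) (c (α y) (c z u))
    + gsign K (pz * (px + py) + px * py) • c (α (α z)) (c (α y) (c x u))
    + gsign K (py * pz) • c (sMul c (px + pz) py (sMul c px pz x z) (α y)) (α (α u))
    = c (α (α x)) (c (sMul c py pz y z) (α u))
    + gsign K (px * (py + pz)) • c (α (α y)) (c (sMul c pz px z x) (α u))
    + gsign K (pz * (px + py)) • c (α (α z)) (c (sMul c px py x y) (α u)))

/-- Hom-dendriform superalgebra, with `p = ≺` and `s = ≻`. -/
def IsHomDendriform (g : ZMod 2 → Submodule K J)
    (p s : J →ₗ[K] J →ₗ[K] J) (α : J →ₗ[K] J) : Prop :=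
  EvenBilin g p ∧ EvenBilin g s ∧ EvenMap g α ∧ IsMult p α ∧ IsMult s α ∧
  (∀ x y z : J, s (α x) (s y z) = s (p x y + s x y) (α z)) ∧
  (∀ x y z : J, p (p x y) (α z) = p (α x) (p y z + s y z)) ∧
  (∀ x y z : J, p (s x y) (α z) = s (α x) (p y z))

/-- Hom-alternative superalgebra. -/
def IsHomAlternative (g : ZMod 2 → Submodule K J) (m : J →ₗ[K] J →ₗ[K] J)
    (α : J →ₗ[K] J) : Prop :=
  EvenBilin g m ∧ EvenMap g α ∧
  (∀ i j : ZMod 2, ∀ x ∈ g i, ∀ y ∈ g j, ∀ z : J,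
    hAss m α x y z = -(gsign K (i * j) • hAss m α y x z)) ∧
  (∀ j k : ZMod 2, ∀ y ∈ g j, ∀ z ∈ g k, ∀ x : J,
    hAss m α x y z = -(gsign K (j * k) • hAss m α x z y))

/-- `ass_l` for a Hom-pre-alternative superalgebra, `p = ≺`, `s = ≻`. -/
def passL (p s : J →ₗ[K] J →ₗ[K] J) (α : J →ₗ[K] J) (x y z : J) : J :=
  s (p x y + s x y) (α z) - s (α x) (s y z)

/-- `ass_m` for a Hom-pre-alternative superalgebra. -/
def passM (p s : J →ₗ[K] J →ₗ[K] J) (α : J →ₗ[K] J) (x y z : J) : J :=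
  p (s x y) (α z) - s (α x) (p y z)

/-- `ass_r` for a Hom-pre-alternative superalgebra. -/
def passR (p s : J →ₗ[K] J →ₗ[K] J) (α : J →ₗ[K] J) (x y z : J) : J :=
  p (p x y) (α z) - p (α x) (p y z + s y z)

/-- Hom-pre-alternative superalgebra. -/
def IsHomPreAlternative (g : ZMod 2 → Submodule K J)
    (p s : J →ₗ[K] J →ₗ[K] J) (α : J →ₗ[K] J) : Prop :=
  EvenBilin g p ∧ EvenBilin g s ∧ EvenMap g α ∧
  (∀ i j : ZMod 2, ∀ x ∈ g i, ∀ y ∈ g j, ∀ z : J,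
    passM p s α x y z + gsign K (i * j) • passR p s α y x z = 0) ∧
  (∀ j k : ZMod 2, ∀ y ∈ g j, ∀ z ∈ g k, ∀ x : J,
    passM p s α x y z + gsign K (j * k) • passL p s α x z y = 0) ∧
  (∀ i j : ZMod 2, ∀ x ∈ g i, ∀ y ∈ g j, ∀ z : J,
    passL p s α x y z + gsign K (i * j) • passL p s α y x z = 0) ∧
  (∀ j k : ZMod 2, ∀ y ∈ g j, ∀ z ∈ g k, ∀ x : J,
    passR p s α x y z + gsign K (j * k) • passR p s α x z y = 0)

/-- `r = Σ Xₗ ⊗ Yₗ` (with `Xₗ, Yₗ` homogeneous of parities `Pₗ, Qₗ`) is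
super skew-symmetric: `σ(r) = -r`. -/
def SkewSol {ι : Type*} [Fintype ι] {A : Type*} [AddCommGroup A] [Module K A]
    (X Y : ι → A) (P Q : ι → ZMod 2) : Prop :=
  (∑ l, gsign K (P l * Q l) • (Y l ⊗ₜ[K] X l)) = -(∑ l, X l ⊗ₜ[K] Y l)

/-- `r = Σ Xₗ ⊗ Yₗ` solves the super Hom-Jordan Yang-Baxter equation
`r₁₂·r₁₃ − r₁₂·r₂₃ + r₁₃·r₂₃ = 0`. -/
def YBESol {ι : Type*} [Fintype ι] {A : Type*} [AddCommGroup A] [Module K A]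
    (mA : A →ₗ[K] A →ₗ[K] A) (γ : A →ₗ[K] A) (X Y : ι → A) (P Q : ι → ZMod 2) : Prop :=
  (∑ l, ∑ l', gsign K (P l' * Q l) • ((mA (X l) (X l') ⊗ₜ[K] γ (Y l)) ⊗ₜ[K] γ (Y l')))
    - (∑ l, ∑ l', (γ (X l) ⊗ₜ[K] mA (Y l) (X l')) ⊗ₜ[K] γ (Y l'))
    + (∑ l, ∑ l', gsign K (P l' * Q l) • ((γ (X l) ⊗ₜ[K] γ (X l')) ⊗ₜ[K] mA (Y l) (Y l')))
    = 0

/-- The left components of the family representing `r = T − σ(T)` in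
`(J ⋉ V*) ⊗ (J ⋉ V*)`, for `T` regarded in `J ⊗ V*` via a homogeneous basis. -/
def rX {n : ℕ} (T : V →ₗ[K] J) (b : Module.Basis (Fin n) K V) (pe : Fin n → ZMod 2) :
    Fin n ⊕ Fin n → J × Module.Dual K V :=
  Sum.elim (fun k => (T (b k), 0))
    (fun k => -(gsign K (pe k * pe k)) • ((0 : J), b.coord k))

/-- The right components of the family representing `r = T − σ(T)`. -/
def rY {n : ℕ} (T : V →ₗ[K] J) (b : Module.Basis (Fin n) K V) :
    Fin n ⊕ Fin n → J × Module.Dual K V :=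
  Sum.elim (fun k => ((0 : J), b.coord k)) (fun k => (T (b k), 0))

/-- The parities of the family representing `r = T − σ(T)`. -/
def rP {n : ℕ} (pe : Fin n → ZMod 2) : Fin n ⊕ Fin n → ZMod 2 := Sum.elim pe pe
/-- The twisted multiplication `x ⋅_α y = α(x) ⋅ α(y)`. -/
def twistMul (m : J →ₗ[K] J →ₗ[K] J) (α : J →ₗ[K] J) : J →ₗ[K] J →ₗ[K] J :=
  ((m.comp α).flip.comp α).flip

/-- a Jordan superalgebra `(J, ·)` together with an even superalgebra
morphism `α` yields a multiplicative Hom-Jordan superalgebra `(J, ·_α, α)` where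
`x ·_α y = α(x)·α(y)`. -/
theorem jordan_yau_twist (g : ZMod 2 → Submodule K J) (hg : DirectSum.IsInternal g)
    (m : J →ₗ[K] J →ₗ[K] J) (α : J →ₗ[K] J)
    (hme : EvenBilin g m) (hcomm : SuperComm g m)
    (hJid : HomJordanId g m LinearMap.id)
    (hαe : EvenMap g α) (hαm : IsMult m α) :
    IsMultHomJordan g (twistMul m α) α := by
  have ht : ∀ x y, twistMul m α x y = m (α x) (α y) := fun x y => rfl
  refine ⟨⟨?_, hαe, ?_, ?_⟩, ?_⟩
  · intro i j x hx y hy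
    rw [ht]
    exact hme i j _ (hαe i x hx) _ (hαe j y hy)
  · intro i j x hx y hy
    rw [ht, ht]
    exact hcomm i j _ (hαe i x hx) _ (hαe j y hy)
  · intro px py pz pu x hx y hy z hz u hu
    have h3 : ∀ i, ∀ v ∈ g i, α (α (α v)) ∈ g i := fun i v hv =>
      hαe i _ (hαe i _ (hαe i _ hv))
    have h := hJid px py pz pu _ (h3 _ x hx) _ (h3 _ y hy) _ (h3 _ z hz) _ (h3 _ u hu)
    have hm : ∀ x y, α (m x y) = m (α x) (α y) := hαm
    simp only [hAss, ht, hm, LinearMap.id_apply] at h ⊢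
    exact h
  · intro x y
    rw [ht, ht]
    exact hαm _ _
end
end

section
/- Let (J, μ, α) be a multiplicative Hom-alternative superalgebra. Then (J, *, α) is a multiplicative Hom-Jordan superalgebra, where x * y = μ(x,y) + (-1)^{|x||y|} μ(y,x) for homogeneous x, y ∈ J. -/
open scoped TensorProduct

noncomputable section

variable {K : Type*} [Field K] [CharZero K]
variable {J V : Type*} [AddCommGroup J] [Module K J] [AddCommGroup V] [Module K V]

theorem gs0 : gsign K 0 = 1 := by simp [gsign]
theorem gs1 : gsign K 1 = -1 := by simp [gsign, ZMod.val_one]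
theorem z2 : (1 + 1 : ZMod 2) = 0 := by decide
theorem z2cases : ∀ p : ZMod 2, p = 0 ∨ p = 1 := by decide

theorem ha_cyc {g : ZMod 2 → Submodule K J} {m : J →ₗ[K] J →ₗ[K] J} {α : J →ₗ[K] J}
    (h : IsHomAlternative g m α) (i j k : ZMod 2) {x y z : J} (hx : x ∈ g i) (hy : y ∈ g j)
    (hz : z ∈ g k) : hAss m α x y z = gsign K (i * (j + k)) • hAss m α y z x := by
  rw [h.2.2.1 i j x hx y hy, h.2.2.2 i k x hx z hz]
  rcases z2cases i with rfl | rfl <;> rcases z2cases j with rfl | rfl <;>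
    rcases z2cases k with rfl | rfl <;> simp [gs0, gs1, z2]

theorem ha_teich {m : J →ₗ[K] J →ₗ[K] J} {α : J →ₗ[K] J} (hm : IsMult m α) (w x y z : J) :
    hAss m α (m w x) (α y) (α z) = hAss m α (α w) (m x y) (α z) - hAss m α (α w) (α x) (m y z)
      + m (α (α w)) (hAss m α x y z) + m (hAss m α w x y) (α (α z)) := by
  simp only [hAss, map_sub, LinearMap.sub_apply, hm _ _]
  abel

/-- Bruck-Kleinfeld function. -/
def BK (m : J →ₗ[K] J →ₗ[K] J) (α : J →ₗ[K] J) (i j k l : ZMod 2) (w x y z : J) : J :=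
  hAss m α (m w x) (α y) (α z) - gsign K (i * j) • m (α (α x)) (hAss m α w y z)
    - gsign K (i * (j + k + l)) • m (hAss m α x y z) (α (α w))

theorem bk_shift {g : ZMod 2 → Submodule K J} {m : J →ₗ[K] J →ₗ[K] J} {α : J →ₗ[K] J}
    (h : IsHomAlternative g m α) (hm : IsMult m α) (i j k l : ZMod 2) {w x y z : J}
    (hw : w ∈ g i) (hx : x ∈ g j) (hy : y ∈ g k) (hz : z ∈ g l) :
    BK m α i j k l w x y z = -(gsign K (l * (i + j + k)) • BK m α l i j k z w x y) := by
  have T1 := ha_teich hm w x y z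
  have T2 := ha_teich hm x y z w
  have hw' := h.2.1 _ _ hw
  have hx' := h.2.1 _ _ hx
  have hy' := h.2.1 _ _ hy
  have hz' := h.2.1 _ _ hz
  have e1 := ha_cyc h i (j + k) l hw' (h.1 _ _ _ hx _ hy) hz'
  have e2 := ha_cyc h i j (k + l) hw' hx' (h.1 _ _ _ hy _ hz)
  have e2' := ha_cyc h j (k + l) i hx' (h.1 _ _ _ hy _ hz) hw'
  have e3 := ha_cyc h j k (l + i) hx' hy' (h.1 _ _ _ hz _ hw)
  have e3' := ha_cyc h k (l + i) j hy' (h.1 _ _ _ hz _ hw) hx'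
  have e4 := ha_cyc h i k l hw hy hz
  have e5 := ha_cyc h l j k hz hx hy
  rw [e1, e2, e2', T2, e2', e3, e3'] at T1
  unfold BK
  rw [T1, e4, e5]
  clear T1 T2 e1 e2 e2' e3 e3' e4 e5
  rcases z2cases i with rfl | rfl <;> rcases z2cases j with rfl | rfl <;>
    rcases z2cases k with rfl | rfl <;> rcases z2cases l with rfl | rfl <;>
    simp only [gs0, gs1, z2, mul_zero, zero_mul, mul_one, add_zero, zero_add, one_smul,
      map_smul, LinearMap.smul_apply] <;> module

theorem bk_swap {g : ZMod 2 → Submodule K J} {m : J →ₗ[K] J →ₗ[K] J} {α : J →ₗ[K] J}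
    (h : IsHomAlternative g m α) (hm : IsMult m α) (i j k l : ZMod 2) {w x y z : J}
    (hw : w ∈ g i) (hx : x ∈ g j) (hy : y ∈ g k) (hz : z ∈ g l) :
    BK m α i j k l w x y z = -(gsign K (i * j) • BK m α j i k l x w y z) := by
  have s : BK m α k l i j y z w x = -(gsign K (i * j) • BK m α k l j i y z x w) := by
    unfold BK
    rw [h.2.2.2 i j _ (h.2.1 _ _ hw) _ (h.2.1 _ _ hx), h.2.2.2 i j _ hw _ hx y,
      h.2.2.2 i j _ hw _ hx z, add_right_comm l j i]
    simp only [map_neg, map_smul, LinearMap.neg_apply, LinearMap.smul_apply]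
    module
  rw [bk_shift h hm i j k l hw hx hy hz, bk_shift h hm l i j k hz hw hx hy, s,
    bk_shift h hm k l j i hy hz hx hw, bk_shift h hm i k l j hw hy hz hx]
  rcases z2cases i with rfl | rfl <;> rcases z2cases j with rfl | rfl <;>
    rcases z2cases k with rfl | rfl <;> rcases z2cases l with rfl | rfl <;>
    simp [gs0, gs1, z2]

theorem ha_sq {g : ZMod 2 → Submodule K J} {m : J →ₗ[K] J →ₗ[K] J} {α : J →ₗ[K] J}
    (h : IsHomAlternative g m α) (hm : IsMult m α) (i j k l : ZMod 2) {x y z u : J}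
    (hx : x ∈ g i) (hy : y ∈ g j) (hz : z ∈ g k) (hu : u ∈ g l) :
    hAss m α (m x y + gsign K (i * j) • m y x) (α z) (α u) =
      m (α (α x)) (hAss m α y z u) + gsign K (i * (j + k + l)) • m (hAss m α y z u) (α (α x))
      + gsign K (i * j) • m (α (α y)) (hAss m α x z u)
      + gsign K (j * (k + l)) • m (hAss m α x z u) (α (α y)) := by
  have s := bk_swap h hm i j k l hx hy hz hu
  have e : hAss m α (m x y + gsign K (i * j) • m y x) (α z) (α u) =
      hAss m α (m x y) (α z) (α u) + gsign K (i * j) • hAss m α (m y x) (α z) (α u) := by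
    simp only [hAss, map_add, map_smul, LinearMap.add_apply, LinearMap.smul_apply]
    module
  rw [e]
  unfold BK at s
  generalize hAss m α (m x y) (α z) (α u) = A at *
  generalize hAss m α (m y x) (α z) (α u) = B at *
  rw [sub_sub, sub_eq_iff_eq_add] at s
  rw [s]
  clear s e
  rcases z2cases i with rfl | rfl <;> rcases z2cases j with rfl | rfl <;>
    rcases z2cases k with rfl | rfl <;> rcases z2cases l with rfl | rfl <;>
    simp only [gs0, gs1, z2, mul_zero, zero_mul, mul_one, add_zero, zero_add, one_smul] <;> module

theorem ha_sq_cyc {g : ZMod 2 → Submodule K J} {m : J →ₗ[K] J →ₗ[K] J} {α : J →ₗ[K] J}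
    (h : IsHomAlternative g m α) (hm : IsMult m α) (px py pz pu : ZMod 2) {x y z u : J}
    (hx : x ∈ g px) (hy : y ∈ g py) (hz : z ∈ g pz) (hu : u ∈ g pu) :
      gsign K (pu * (px + pz)) • hAss m α (m x y + gsign K (px * py) • m y x) (α z) (α u)
    + gsign K (px * (py + pz)) • hAss m α (m y u + gsign K (py * pu) • m u y) (α z) (α x)
    + gsign K (py * (pu + pz)) • hAss m α (m u x + gsign K (pu * px) • m x u) (α z) (α y) = 0 := by
  rw [ha_sq h hm _ _ _ _ hx hy hz hu, ha_sq h hm _ _ _ _ hy hu hz hx,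
    ha_sq h hm _ _ _ _ hu hx hz hy]
  have sw : ∀ {i j k : ZMod 2} {a b c : J}, a ∈ g i → b ∈ g j → c ∈ g k → hAss m α a b c =
      -(gsign K (i * j + i * k + j * k) • hAss m α c b a) := by
    intro i j k a b c ha hb hc
    rw [ha_cyc h i j k ha hb hc, h.2.2.1 j k b hb c hc]
    rcases z2cases i with rfl | rfl <;> rcases z2cases j with rfl | rfl <;>
      rcases z2cases k with rfl | rfl <;> simp [gs0, gs1, z2]
  rw [sw hy hz hu, sw hx hz hu, sw hy hz hx]
  rcases z2cases px with rfl | rfl <;> rcases z2cases py with rfl | rfl <;>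
    rcases z2cases pz with rfl | rfl <;> rcases z2cases pu with rfl | rfl <;>
    simp only [gs0, gs1, z2, mul_zero, zero_mul, mul_one, add_zero, zero_add, one_smul,
      map_smul, LinearMap.smul_apply, map_neg, LinearMap.neg_apply] <;> module

/-- Super-bracket. -/
def sBr (m : J →ₗ[K] J →ₗ[K] J) (i j : ZMod 2) (x y : J) : J :=
  m x y - gsign K (i * j) • m y x

theorem ass_star {g : ZMod 2 → Submodule K J} {m st : J →ₗ[K] J →ₗ[K] J} {α : J →ₗ[K] J}
    (h : IsHomAlternative g m α)
    (hst : ∀ i j : ZMod 2, ∀ x ∈ g i, ∀ y ∈ g j, st x y = m x y + gsign K (i * j) • m y x)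
    (hev : EvenBilin g st) (i j k : ZMod 2) {a b c : J}
    (ha : a ∈ g i) (hb : b ∈ g j) (hc : c ∈ g k) :
    hAss st α a b c = (-2 : K) • hAss m α a b c
      + gsign K (i * j) • sBr m j (i + k) (α b) (sBr m i k a c) := by
  have e1 : hAss m α c b a = -(gsign K (i * j + i * k + j * k) • hAss m α a b c) := by
    rw [ha_cyc h k j i hc hb ha, h.2.2.1 j i b hb a ha]
    rcases z2cases i with rfl | rfl <;> rcases z2cases j with rfl | rfl <;>
      rcases z2cases k with rfl | rfl <;> simp [gs0, gs1, z2]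
  have e2 := h.2.2.1 j i b hb a ha c
  have e3 : hAss m α c a b = gsign K (i * k + j * k) • hAss m α a b c := by
    rw [ha_cyc h k i j hc ha hb, mul_add, mul_comm k i, mul_comm k j]
  have e4 := h.2.2.2 k j c hc b hb a
  have e5 : hAss m α b c a = gsign K (i * j + i * k) • hAss m α a b c := by
    rw [ha_cyc h j k i hb hc ha, ha_cyc h k i j hc ha hb]
    rcases z2cases i with rfl | rfl <;> rcases z2cases j with rfl | rfl <;>
      rcases z2cases k with rfl | rfl <;> simp [gs0, gs1, z2]
  have hA : hAss st α a b c = m (m a b) (α c) + gsign K (i * j) • m (m b a) (α c)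
      + gsign K ((i + j) * k) • (m (α c) (m a b) + gsign K (i * j) • m (α c) (m b a))
      - (m (α a) (m b c) + gsign K (j * k) • m (α a) (m c b)
      + gsign K (i * (j + k)) • (m (m b c) (α a) + gsign K (j * k) • m (m c b) (α a))) := by
    unfold hAss
    rw [hst _ _ _ (hev _ _ _ ha _ hb) _ (h.2.1 _ _ hc),
      hst _ _ _ (h.2.1 _ _ ha) _ (hev _ _ _ hb _ hc), hst _ _ _ ha _ hb, hst _ _ _ hb _ hc]
    simp only [map_add, map_smul, LinearMap.add_apply, LinearMap.smul_apply]
  rw [hA]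
  unfold sBr
  have f : ∀ p q r : J, m (m p q) (α r) = hAss m α p q r + m (α p) (m q r) := by
    intro p q r
    simp [hAss]
  have f2 := f c a b
  have f3 := f a c b
  simp only [map_sub, map_smul, LinearMap.sub_apply, LinearMap.smul_apply, f]
  rw [e1, e2, e3, e4, e5]
  clear e1 e2 e3 e4 e5 hA f f2 f3
  rcases z2cases i with rfl | rfl <;> rcases z2cases j with rfl | rfl <;>
    rcases z2cases k with rfl | rfl <;>
    simp only [gs0, gs1, z2, mul_zero, zero_mul, mul_one, add_zero, zero_add, one_smul] <;> module

theorem br_cyc {g : ZMod 2 → Submodule K J} {m : J →ₗ[K] J →ₗ[K] J} {α : J →ₗ[K] J}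
    (h : IsHomAlternative g m α) (i j k : ZMod 2) {x y u : J}
    (hx : x ∈ g i) (hy : y ∈ g j) (hu : u ∈ g k) :
    gsign K (k * i) • sBr m (i + j) k (m x y + gsign K (i * j) • m y x) (α u)
    + gsign K (i * j) • sBr m (j + k) i (m y u + gsign K (j * k) • m u y) (α x)
    + gsign K (j * k) • sBr m (k + i) j (m u x + gsign K (k * i) • m x u) (α y) = 0 := by
  have f : ∀ p q r : J, m (m p q) (α r) = hAss m α p q r + m (α p) (m q r) := by
    intro p q r
    simp [hAss]
  unfold sBr
  simp only [map_add, map_smul, LinearMap.add_apply, LinearMap.smul_apply, f]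
  rw [h.2.2.1 j i y hy x hx u, h.2.2.2 k j u hu y hy x, ha_cyc h k i j hu hx hy,
    ha_cyc h k j i hu hy hx, h.2.2.1 j i y hy x hx u, ha_cyc h j k i hy hu hx,
    ha_cyc h k i j hu hx hy]
  rcases z2cases i with rfl | rfl <;> rcases z2cases j with rfl | rfl <;>
    rcases z2cases k with rfl | rfl <;>
    simp only [gs0, gs1, z2, mul_zero, zero_mul, mul_one, add_zero, zero_add, one_smul] <;> module

/-- a multiplicative Hom-alternative superalgebra gives a multiplicative
Hom-Jordan superalgebra via `x * y = μ(x,y) + (-1)^{|x||y|} μ(y,x)`. -/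
theorem homAlternative_to_homJordan (g : ZMod 2 → Submodule K J)
    (hg : DirectSum.IsInternal g)
    (μ : J →ₗ[K] J →ₗ[K] J) (α : J →ₗ[K] J)
    (hAlt : IsHomAlternative g μ α) (hμm : IsMult μ α)
    (star : J →ₗ[K] J →ₗ[K] J)
    (hstar : ∀ i j : ZMod 2, ∀ x ∈ g i, ∀ y ∈ g j,
      star x y = μ x y + gsign K (i * j) • μ y x) :
    IsMultHomJordan g star α := by
  have hα := hAlt.2.1
  have hev : EvenBilin g star := by
    intro i j x hx y hy
    rw [hstar i j x hx y hy]
    refine add_mem (hAlt.1 _ _ _ hx _ hy) (Submodule.smul_mem _ _ ?_)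
    rw [add_comm]
    exact hAlt.1 _ _ _ hy _ hx
  refine ⟨⟨hev, hα, ?_, ?_⟩, ?_⟩
  · intro i j x hx y hy
    rw [hstar i j x hx y hy, hstar j i y hy x hx]
    rcases z2cases i with rfl | rfl <;> rcases z2cases j with rfl | rfl <;>
      simp [gs0, gs1, add_comm]
  · intro px py pz pu x hx y hy z hz u hu
    rw [ass_star hAlt hstar hev _ _ _ (hev _ _ _ hx _ hy) (hα _ _ hz) (hα _ _ hu),
      ass_star hAlt hstar hev _ _ _ (hev _ _ _ hy _ hu) (hα _ _ hz) (hα _ _ hx),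
      ass_star hAlt hstar hev _ _ _ (hev _ _ _ hu _ hx) (hα _ _ hz) (hα _ _ hy),
      hstar _ _ _ hx _ hy, hstar _ _ _ hy _ hu, hstar _ _ _ hu _ hx]
    have c1 := ha_sq_cyc hAlt hμm px py pz pu hx hy hz hu
    have c2 := congrArg (sBr μ pz (px + py + pu) (α (α z))) (br_cyc hAlt px py pu hx hy hu)
    have lin : ∀ (i j : ZMod 2) (v a b c : J) (r s t : K),
        sBr μ i j v (r • a + s • b + t • c) =
          r • sBr μ i j v a + s • sBr μ i j v b + t • sBr μ i j v c := by
      intro i j v a b c r s t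
      simp only [sBr, map_add, map_smul, LinearMap.add_apply, LinearMap.smul_apply]
      module
    have lz : ∀ (i j : ZMod 2) (v : J), sBr μ i j v 0 = 0 := by
      intro i j v
      simp [sBr]
    rw [lin, lz] at c2
    have p1 : py + pu + px = px + py + pu := by ring
    have p2 : pu + px + py = px + py + pu := by ring
    rw [p1, p2]
    generalize hAss μ α (μ x y + gsign K (px * py) • μ y x) (α z) (α u) = A1 at *
    generalize hAss μ α (μ y u + gsign K (py * pu) • μ u y) (α z) (α x) = A2 at *
    generalize hAss μ α (μ u x + gsign K (pu * px) • μ x u) (α z) (α y) = A3 at *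
    generalize sBr μ pz (px + py + pu) (α (α z)) (sBr μ (px + py) pu _ _) = B1 at *
    generalize sBr μ pz (px + py + pu) (α (α z)) (sBr μ (py + pu) px _ _) = B2 at *
    generalize sBr μ pz (px + py + pu) (α (α z)) (sBr μ (pu + px) py _ _) = B3 at *
    have key : gsign K (pu * (px + pz)) • ((-2 : K) • A1 + gsign K ((px + py) * pz) • B1)
        + gsign K (px * (py + pz)) • ((-2 : K) • A2 + gsign K ((py + pu) * pz) • B2)
        + gsign K (py * (pu + pz)) • ((-2 : K) • A3 + gsign K ((pu + px) * pz) • B3)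
        = (-2 : K) • (gsign K (pu * (px + pz)) • A1 + gsign K (px * (py + pz)) • A2
          + gsign K (py * (pu + pz)) • A3)
        + gsign K ((px + py + pu) * pz) • (gsign K (pu * px) • B1 + gsign K (px * py) • B2
          + gsign K (py * pu) • B3) := by
      clear c1 c2 p1 p2 lin lz
      rcases z2cases px with rfl | rfl <;> rcases z2cases py with rfl | rfl <;>
        rcases z2cases pz with rfl | rfl <;> rcases z2cases pu with rfl | rfl <;>
        simp only [gs0, gs1, z2, mul_zero, zero_mul, mul_one, add_zero, zero_add, one_smul] <;>
        module
    rw [key, c1, c2, smul_zero, smul_zero, add_zero]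
  · have hom : ∀ i j : ZMod 2, ∀ x ∈ g i, ∀ y ∈ g j, α (star x y) = star (α x) (α y) := by
      intro i j x hx y hy
      rw [hstar i j x hx y hy, hstar i j _ (hα _ _ hx) _ (hα _ _ hy)]
      simp only [map_add, map_smul, hμm _ _]
    have top := hg.submodule_iSup_eq_top
    intro x y
    have hx : x ∈ ⨆ i, g i := by rw [top]; trivial
    have hy : y ∈ ⨆ i, g i := by rw [top]; trivial
    induction hx using Submodule.iSup_induction' with
    | zero => simp
    | add a b _ _ ha hb => simp only [map_add, LinearMap.add_apply, ha, hb]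
    | mem i a ha =>
      induction hy using Submodule.iSup_induction' with
      | zero => simp
      | add c d _ _ hc hd => simp only [map_add, hc, hd]
      | mem j c hc => exact hom i j a ha c hc
end
end

section
/- Let (J, ·, α) be a multiplicative Hom-Jordan superalgebra, V a Z₂-graded vector space, β an even endomorphism of V, and π : J → End(V) an even linear map. Then (V, π, β) is a representation of (J, ·, α) if and only if the direct sum J ⊕ V equipped with the even product (x+u) ∗ (y+v) = x·y + π(x)v + (-1)^{|u||y|} π(y)u (for homogeneous x,y ∈ J, u,v ∈ V) and the twist map (α ⊕ β)(x+u) = α(x) + β(u) is a multiplicative Hom-Jordan superalgebra (the semi-direct product J ⋉ V). -/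
open scoped TensorProduct

noncomputable section

variable {K : Type*} [Field K] [CharZero K]
variable {J V : Type*} [AddCommGroup J] [Module K J] [AddCommGroup V] [Module K V]

lemma gsign_cases (K : Type*) [Field K] : gsign K 0 = 1 ∧ gsign K 1 = -1 := by
  constructor
  · simp [gsign]
  · simp [gsign, ZMod.val_one]

lemma zmod2_cases (p : ZMod 2) : p = 0 ∨ p = 1 := by
  revert p; decide

lemma decomp2 {K J : Type*} [Field K] [AddCommGroup J] [Module K J]
    (g : ZMod 2 → Submodule K J) (hg : DirectSum.IsInternal g) (x : J) :
    ∃ a ∈ g 0, ∃ b ∈ g 1, x = a + b := by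
  have h : x ∈ ⨆ i, g i := by rw [hg.submodule_iSup_eq_top]; trivial
  induction h using Submodule.iSup_induction' with
  | mem i x hx =>
    rcases zmod2_cases i with rfl | rfl
    · exact ⟨x, hx, 0, zero_mem _, by simp⟩
    · exact ⟨0, zero_mem _, x, hx, by simp⟩
  | zero => exact ⟨0, zero_mem _, 0, zero_mem _, by simp⟩
  | add x y _ _ hx hy =>
    obtain ⟨a, ha, b, hb, rfl⟩ := hx
    obtain ⟨c, hc, d, hd, rfl⟩ := hy
    exact ⟨a + c, add_mem ha hc, b + d, add_mem hb hd, by abel⟩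

lemma hAss_formula {K : Type*} [Field K]
    {J V : Type*} [AddCommGroup J] [Module K J] [AddCommGroup V] [Module K V]
    (g : ZMod 2 → Submodule K J)
    (m : J →ₗ[K] J →ₗ[K] J) (α : J →ₗ[K] J) (hm : EvenBilin g m) (hα : EvenMap g α)
    (gV : ZMod 2 → Submodule K V)
    (π : J →ₗ[K] Module.End K V) (β : Module.End K V)
    (hπe : EvenRepMap g gV π) (hβe : ∀ i : ZMod 2, ∀ v ∈ gV i, β v ∈ gV i)
    (m' : (J × V) →ₗ[K] (J × V) →ₗ[K] (J × V))
    (hm' : IsSemidirectMul g gV m π m')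
    (px py pz pu : ZMod 2) (x y z u : J) (a b c d : V)
    (hx : x ∈ g px) (hy : y ∈ g py) (hz : z ∈ g pz) (hu : u ∈ g pu)
    (ha : a ∈ gV px) (hb : b ∈ gV py) (hc : c ∈ gV pz) (hd : d ∈ gV pu) :
    hAss m' (α.prodMap β) (m' (x, a) (y, b)) (α.prodMap β (z, c)) (α.prodMap β (u, d)) =
    (hAss m α (m x y) (α z) (α u),
      π (m (m x y) (α z)) (β (β d))
      + gsign K ((px + py + pz) * pu) • π (α (α u)) (π (m x y) (β c)
        + gsign K ((px + py) * pz) • π (α z) (π x b + gsign K (px * py) • π y a))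
      - (π (α (m x y)) (π (α z) (β d) + gsign K (pz * pu) • π (α u) (β c))
        + gsign K ((px + py) * (pz + pu)) •
          π (m (α z) (α u)) (β (π x b + gsign K (px * py) • π y a)))) := by
  have hxy := hm _ _ x hx y hy
  have hab : π x b + gsign K (px * py) • π y a ∈ gV (px + py) :=
    add_mem (hπe _ _ x hx b hb)
      (Submodule.smul_mem _ _ (by rw [add_comm]; exact hπe _ _ y hy a ha))
  have hαz := hα _ z hz
  have hαu := hα _ u hu
  have hβc := hβe _ c hc
  have hβd := hβe _ d hd
  have hzu := hm _ _ _ hαz _ hαu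
  have hcd : π (α z) (β d) + gsign K (pz * pu) • π (α u) (β c) ∈ gV (pz + pu) :=
    add_mem (hπe _ _ _ hαz _ hβd)
      (Submodule.smul_mem _ _ (by rw [add_comm]; exact hπe _ _ _ hαu _ hβc))
  have hxyz := hm _ _ _ hxy _ hαz
  have h3 : π (m x y) (β c) + gsign K ((px + py) * pz) •
      π (α z) (π x b + gsign K (px * py) • π y a) ∈ gV (px + py + pz) :=
    add_mem (hπe _ _ _ hxy _ hβc)
      (Submodule.smul_mem _ _ (by rw [add_comm]; exact hπe _ _ _ hαz _ hab))
  unfold hAss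
  rw [hm' px py x hx a ha y hy b hb]
  simp only [LinearMap.prodMap_apply]
  rw [hm' (px + py) pz _ hxy _ hab _ hαz _ hβc,
    hm' pz pu _ hαz _ hβc _ hαu _ hβd,
    hm' (px + py + pz) pu _ hxyz _ h3 _ (hα _ _ hαu) _ (hβe _ _ hβd),
    hm' (px + py) (pz + pu) _ (hα _ _ hxy) _ (hβe _ _ hab) _ hzu _ hcd]
  rfl

set_option maxHeartbeats 4000000

/-- `(V, π, β)` is a representation of the multiplicative Hom-Jordan
superalgebra `(J, ·, α)` if and only if the semi-direct product `J ⋉ V` is a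
multiplicative Hom-Jordan superalgebra. -/
theorem rep_iff_semidirect_homJordan (g : ZMod 2 → Submodule K J)
    (hg : DirectSum.IsInternal g)
    (m : J →ₗ[K] J →ₗ[K] J) (α : J →ₗ[K] J) (hJ : IsMultHomJordan g m α)
    (gV : ZMod 2 → Submodule K V) (hgV : DirectSum.IsInternal gV)
    (π : J →ₗ[K] Module.End K V) (β : Module.End K V)
    (hπe : EvenRepMap g gV π) (hβe : ∀ i : ZMod 2, ∀ v ∈ gV i, β v ∈ gV i)
    (m' : (J × V) →ₗ[K] (J × V) →ₗ[K] (J × V))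
    (hm' : IsSemidirectMul g gV m π m') :
    IsRep g m α gV π β ↔
      IsMultHomJordan (prodGrading g gV) m' (α.prodMap β) := by
  obtain ⟨⟨hm, hα, hsc, hJid⟩, hmul⟩ := hJ
  obtain ⟨s0, s1⟩ := gsign_cases K
  have z11 : (1 : ZMod 2) + 1 = 0 := by decide
  have F := hAss_formula g m α hm hα gV π β hπe hβe m' hm'
  constructor
  · rintro ⟨-, -, h1, h2, h3⟩
    have h1' : ∀ x v, β (π x v) = π (α x) (β v) := fun x v =>
      LinearMap.congr_fun (h1 x) v
    refine ⟨⟨?_, ?_, ?_, ?_⟩, ?_⟩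
    · rintro i j ⟨x, a⟩ ⟨hx, ha⟩ ⟨y, b⟩ ⟨hy, hb⟩
      simp only at hx ha hy hb
      rw [hm' i j x hx a ha y hy b hb]
      exact ⟨hm _ _ _ hx _ hy, add_mem (hπe _ _ x hx b hb)
        (Submodule.smul_mem _ _ (by rw [add_comm]; exact hπe _ _ y hy a ha))⟩
    · rintro i ⟨x, a⟩ ⟨hx, ha⟩
      exact ⟨hα _ _ hx, hβe _ _ ha⟩
    · rintro i j ⟨x, a⟩ ⟨hx, ha⟩ ⟨y, b⟩ ⟨hy, hb⟩
      simp only at hx ha hy hb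
      rw [hm' i j x hx a ha y hy b hb, hm' j i y hy b hb x hx a ha, Prod.smul_mk,
        ← hsc i j x hx y hy]
      congr 1
      rcases zmod2_cases i with rfl | rfl <;> rcases zmod2_cases j with rfl | rfl <;>
        simp only [mul_zero, mul_one, zero_mul, s0, s1] <;> module
    · rintro px py pz pu ⟨x, a⟩ ⟨hx, ha⟩ ⟨y, b⟩ ⟨hy, hb⟩ ⟨z, c⟩ ⟨hz, hc⟩ ⟨u, d⟩ ⟨hu, hd⟩
      simp only at hx ha hy hb hz hc hu hd
      rw [F px py pz pu x y z u a b c d hx hy hz hu ha hb hc hd,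
        F py pu pz px y u z x b d c a hy hu hz hx hb hd hc ha,
        F pu px pz py u x z y d a c b hu hx hz hy hd ha hc hb]
      simp only [Prod.smul_mk, Prod.mk_add_mk]
      rw [hJid px py pz pu x hx y hy z hz u hu]
      refine Prod.ext rfl ?_
      simp only [Prod.snd_zero]
      have Hc := LinearMap.congr_fun (h2 px py pu x hx y hy u hu) c
      have Hd := LinearMap.congr_fun (h3 px pz py x hx z hz y hy) d
      have Ha := LinearMap.congr_fun (h3 py pz pu y hy z hz u hu) a
      have Hb := LinearMap.congr_fun (h3 pu pz px u hu z hz x hx) b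
      rw [hsc _ _ _ (hα _ _ hz) _ (hα _ _ hy), hsc _ _ _ (hα _ _ hy) _ (hα _ _ hx)] at Hd
      rw [hsc _ _ _ (hα _ _ hz) _ (hα _ _ hu), hsc _ _ _ (hα _ _ hu) _ (hα _ _ hy)] at Ha
      rw [hsc _ _ _ (hα _ _ hz) _ (hα _ _ hx), hsc _ _ _ (hα _ _ hx) _ (hα _ _ hu)] at Hb
      rw [hsc _ _ _ (hα _ _ hz) _ (hα _ _ hx), hsc _ _ _ (hα _ _ hz) _ (hα _ _ hy),
        hsc _ _ _ (hα _ _ hz) _ (hα _ _ hu)]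
      simp only [LinearMap.add_apply, LinearMap.smul_apply, Module.End.mul_apply, map_add,
        map_smul, smul_add, smul_sub, h1', hmul _ _] at Ha Hb Hc Hd ⊢
      have key := congrArg₂ (· + ·) (congrArg₂ (· + ·)
        (congrArg (gsign K (px * (py + pz) + pu * pz + py * pu) • ·) Ha)
        (congrArg (gsign K (py * (pu + pz) + px * pz + pu * px) • ·) Hb))
        (congrArg₂ (· + ·) Hc
        (congrArg (gsign K (pu * (px + pz) + py * pz + px * py) • ·) Hd))
      beta_reduce at key
      clear Ha Hb Hc Hd
      rcases zmod2_cases px with rfl | rfl <;> rcases zmod2_cases py with rfl | rfl <;>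
        rcases zmod2_cases pz with rfl | rfl <;> rcases zmod2_cases pu with rfl | rfl <;>
        simp only [mul_zero, mul_one, zero_mul, add_zero, zero_add, z11, s0, s1, one_smul,
          neg_smul, map_neg, LinearMap.neg_apply, smul_neg, neg_neg] at key ⊢ <;>
        linear_combination (norm := module) -key
    · rintro ⟨x, a⟩ ⟨y, b⟩
      obtain ⟨x0, hx0, x1, hx1, rfl⟩ := decomp2 g hg x
      obtain ⟨y0, hy0, y1, hy1, rfl⟩ := decomp2 g hg y
      obtain ⟨a0, ha0, a1, ha1, rfl⟩ := decomp2 gV hgV a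
      obtain ⟨b0, hb0, b1, hb1, rfl⟩ := decomp2 gV hgV b
      have H : ∀ i j : ZMod 2, ∀ x ∈ g i, ∀ u ∈ gV i, ∀ y ∈ g j, ∀ v ∈ gV j,
          α.prodMap β (m' (x, u) (y, v)) = m' (α.prodMap β (x, u)) (α.prodMap β (y, v)) := by
        intro i j x hx u hu y hy v hv
        rw [hm' i j x hx u hu y hy v hv]
        simp only [LinearMap.prodMap_apply]
        rw [hm' i j _ (hα _ _ hx) _ (hβe _ _ hu) _ (hα _ _ hy) _ (hβe _ _ hv)]
        simp only [map_add, map_smul, h1', hmul x y]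
      rw [← Prod.mk_add_mk, ← Prod.mk_add_mk]
      simp only [map_add, LinearMap.add_apply]
      rw [H 0 0 x0 hx0 a0 ha0 y0 hy0 b0 hb0, H 0 1 x0 hx0 a0 ha0 y1 hy1 b1 hb1,
        H 1 0 x1 hx1 a1 ha1 y0 hy0 b0 hb0, H 1 1 x1 hx1 a1 ha1 y1 hy1 b1 hb1]
  · rintro ⟨⟨-, -, -, hid⟩, hmu⟩
    have h1h : ∀ i j : ZMod 2, ∀ x ∈ g i, ∀ v ∈ gV j, β (π x v) = π (α x) (β v) := by
      intro i j x hx v hv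
      have h := hmu (x, 0) (0, v)
      rw [hm' i j x hx 0 (zero_mem _) 0 (zero_mem _) v hv] at h
      simp only [LinearMap.prodMap_apply] at h
      rw [hm' i j _ (hα _ _ hx) _ (hβe _ _ (zero_mem _)) _ (hα _ _ (zero_mem _)) _
        (hβe _ _ hv)] at h
      simpa using congrArg Prod.snd h
    have h1' : ∀ x v, β (π x v) = π (α x) (β v) := by
      intro x v
      obtain ⟨x0, hx0, x1, hx1, rfl⟩ := decomp2 g hg x
      obtain ⟨v0, hv0, v1, hv1, rfl⟩ := decomp2 gV hgV v
      simp only [map_add, LinearMap.add_apply]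
      rw [h1h 0 0 x0 hx0 v0 hv0, h1h 0 1 x0 hx0 v1 hv1, h1h 1 0 x1 hx1 v0 hv0,
        h1h 1 1 x1 hx1 v1 hv1]
    have ext2 : ∀ f f' : Module.End K V, (∀ j : ZMod 2, ∀ v ∈ gV j, f v = f' v) → f = f' := by
      intro f f' h
      ext v
      obtain ⟨v0, hv0, v1, hv1, rfl⟩ := decomp2 gV hgV v
      rw [map_add, map_add, h 0 v0 hv0, h 1 v1 hv1]
    refine ⟨hπe, hβe, fun x => LinearMap.ext (h1' x), ?_, ?_⟩
    · intro px py pu x hx y hy u hu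
      refine ext2 _ _ fun pz c hc => ?_
      have key := hid px py pz pu (x, 0) ⟨hx, zero_mem _⟩ (y, 0) ⟨hy, zero_mem _⟩
        (0, c) ⟨zero_mem _, hc⟩ (u, 0) ⟨hu, zero_mem _⟩
      rw [F px py pz pu x y 0 u 0 0 c 0 hx hy (zero_mem _) hu (zero_mem _) (zero_mem _) hc
          (zero_mem _),
        F py pu pz px y u 0 x 0 0 c 0 hy hu (zero_mem _) hx (zero_mem _) (zero_mem _) hc
          (zero_mem _),
        F pu px pz py u x 0 y 0 0 c 0 hu hx (zero_mem _) hy (zero_mem _) (zero_mem _) hc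
          (zero_mem _)] at key
      replace key := congrArg Prod.snd key
      simp only [Prod.smul_mk, Prod.mk_add_mk, Prod.snd_zero] at key
      simp only [LinearMap.add_apply, LinearMap.smul_apply, Module.End.mul_apply, map_add,
        map_smul, smul_add, smul_sub, h1', hmul _ _, map_zero, LinearMap.zero_apply,
        smul_zero, add_zero, zero_add, sub_zero, zero_sub] at key ⊢
      rcases zmod2_cases px with rfl | rfl <;> rcases zmod2_cases py with rfl | rfl <;>
        rcases zmod2_cases pz with rfl | rfl <;> rcases zmod2_cases pu with rfl | rfl <;>
        simp only [mul_zero, mul_one, zero_mul, add_zero, zero_add, z11, s0, s1, one_smul,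
          neg_smul, smul_neg, neg_neg] at key ⊢ <;>
        linear_combination (norm := module) -key
    · intro px pz py x hx z hz y hy
      refine ext2 _ _ fun pu d hd => ?_
      have key := hid px py pz pu (x, 0) ⟨hx, zero_mem _⟩ (y, 0) ⟨hy, zero_mem _⟩
        (z, 0) ⟨hz, zero_mem _⟩ (0, d) ⟨zero_mem _, hd⟩
      rw [F px py pz pu x y z 0 0 0 0 d hx hy hz (zero_mem _) (zero_mem _) (zero_mem _)
          (zero_mem _) hd,
        F py pu pz px y 0 z x 0 d 0 0 hy (zero_mem _) hz hx (zero_mem _) hd (zero_mem _)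
          (zero_mem _),
        F pu px pz py 0 x z y d 0 0 0 (zero_mem _) hx hz hy hd (zero_mem _) (zero_mem _)
          (zero_mem _)] at key
      replace key := congrArg Prod.snd key
      simp only [Prod.smul_mk, Prod.mk_add_mk, Prod.snd_zero] at key
      rw [hsc _ _ _ (hα _ _ hz) _ (hα _ _ hy), hsc _ _ _ (hα _ _ hy) _ (hα _ _ hx)]
      rw [hsc _ _ _ (hα _ _ hz) _ (hα _ _ hx), hsc _ _ _ (hα _ _ hz) _ (hα _ _ hy)] at key
      simp only [LinearMap.add_apply, LinearMap.smul_apply, Module.End.mul_apply, map_add,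
        map_smul, smul_add, smul_sub, h1', hmul _ _, map_zero, LinearMap.zero_apply,
        smul_zero, add_zero, zero_add, sub_zero, zero_sub] at key ⊢
      replace key := congrArg (gsign K (pu * (px + pz) + py * pz + px * py) • ·) key
      beta_reduce at key
      rcases zmod2_cases px with rfl | rfl <;> rcases zmod2_cases py with rfl | rfl <;>
        rcases zmod2_cases pz with rfl | rfl <;> rcases zmod2_cases pu with rfl | rfl <;>
        simp only [mul_zero, mul_one, zero_mul, add_zero, zero_add, z11, s0, s1, one_smul,
          neg_smul, map_neg, LinearMap.neg_apply, smul_neg, neg_neg] at key ⊢ <;>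
        linear_combination (norm := module) -key
end
end

section
/- Let (V, π, β) be a representation of a multiplicative Hom-Jordan superalgebra (J, ·, α) with α and β invertible. Define π⋆ : J → End(V*) by π⋆(x)(ξ) = π*(α(x))((β⁻²)*(ξ)), equivalently ⟨π⋆(x)(ξ), u⟩ = (-1)^{|x||ξ|} ⟨ξ, π(α⁻¹(x))(β⁻²(u))⟩ for homogeneous x ∈ J, ξ ∈ V*, u ∈ V. Then (V*, π⋆, (β⁻¹)*) is a representation of (J, ·, α), called the dual representation of (V, π, β). -/
open scoped TensorProduct

noncomputable section

variable {K : Type*} [Field K] [CharZero K]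
variable {J V : Type*} [AddCommGroup J] [Module K J] [AddCommGroup V] [Module K V]

theorem gsign_add' (a b : ZMod 2) : gsign K a * gsign K b = gsign K (a + b) := by
  have h : ∀ a b : ZMod 2, (a + b).val % 2 = (a.val + b.val) % 2 := by decide
  unfold gsign
  rw [← pow_add, neg_one_pow_eq_pow_mod_two, ← h, ← neg_one_pow_eq_pow_mod_two]

theorem sgn4 (f : ZMod 2 → ZMod 2 → ZMod 2 → ZMod 2 → ZMod 2 × ZMod 2 × ZMod 2)
    (hf : ∀ p q r j, (f p q r j).1 + (f p q r j).2.1 = j * (p + q + r) + (f p q r j).2.2)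
    (p q r j : ZMod 2) : gsign K (f p q r j).1 * gsign K (f p q r j).2.1
      = gsign K (j * (p + q + r)) * gsign K (f p q r j).2.2 := by
  rw [gsign_add', gsign_add', hf]

theorem isCompl_grading (g : ZMod 2 → Submodule K J) (hg : DirectSum.IsInternal g) (i : ZMod 2) :
    IsCompl (g i) (g (i + 1)) := by
  refine hg.isCompl ?_ ?_
  · revert i; decide
  · ext k
    simp only [Set.mem_univ, Set.mem_insert_iff, Set.mem_singleton_iff, true_iff]
    revert i k; decide

theorem symm_even (g : ZMod 2 → Submodule K J) (hg : DirectSum.IsInternal g) (e : J ≃ₗ[K] J)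
    (he : ∀ i : ZMod 2, ∀ x ∈ g i, e x ∈ g i) (i : ZMod 2) (x : J) (hx : x ∈ g i) :
    e.symm x ∈ g i := by
  have hc := isCompl_grading g hg i
  obtain ⟨a, ha, b, hb, hab⟩ := Submodule.mem_sup.1
    (show e.symm x ∈ g i ⊔ g (i + 1) by rw [hc.sup_eq_top]; trivial)
  have h1 : e a + e b = x := by rw [← map_add, hab, e.apply_symm_apply]
  have h2 : e b ∈ g i := by
    have : e b = x - e a := by rw [← h1]; abel
    rw [this]; exact (g i).sub_mem hx (he _ _ ha)
  have h3 : e b = 0 := Submodule.disjoint_def.1 hc.disjoint _ h2 (he _ _ hb)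
  have h4 : b = 0 := by simpa using h3
  rw [← hab, h4, add_zero]; exact ha

theorem dual_ext (gV : ZMod 2 → Submodule K V) (hgV : DirectSum.IsInternal gV)
    (f f' : Module.End K (Module.Dual K V))
    (h : ∀ j : ZMod 2, ∀ ξ ∈ dualGrading gV j, ∀ u, f ξ u = f' ξ u) : f = f' := by
  have hc := isCompl_grading gV hgV 0
  have hz : ∀ j, ∀ ξ ∈ dualGrading gV j, f ξ = f' ξ :=
    fun j ξ hξ => LinearMap.ext (h j ξ hξ)
  ext1 ξ
  let p := (gV 0).projection _ hc
  have e : ξ = ξ ∘ₗ p + ξ ∘ₗ (LinearMap.id - p) := by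
    ext v; simp
  rw [e, map_add, map_add, hz 0, hz 1]
  · intro x hx
    have : p x = x := Submodule.projection_apply_of_mem_left hc hx
    simp [this]
  · intro x hx
    have : p x = 0 := Submodule.projection_apply_of_mem_right hc hx
    simp [this]

/-- the dual representation `(V*, π⋆, (β⁻¹)*)` of a representation
`(V, π, β)` (with `α`, `β` invertible) of a multiplicative Hom-Jordan superalgebra,
where `⟨π⋆(x)ξ, u⟩ = (-1)^{|x||ξ|} ⟨ξ, π(α⁻¹x)(β⁻²u)⟩`, is again a representation. -/
theorem dual_representation [FiniteDimensional K V]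
    (g : ZMod 2 → Submodule K J) (hg : DirectSum.IsInternal g)
    (m : J →ₗ[K] J →ₗ[K] J) (α : J ≃ₗ[K] J)
    (hJ : IsMultHomJordan g m α.toLinearMap)
    (gV : ZMod 2 → Submodule K V) (hgV : DirectSum.IsInternal gV)
    (π : J →ₗ[K] Module.End K V) (β : V ≃ₗ[K] V)
    (hrep : IsRep g m α.toLinearMap gV π β.toLinearMap)
    (πs : J →ₗ[K] Module.End K (Module.Dual K V))
    (hπs : ∀ i j : ZMod 2, ∀ x ∈ g i, ∀ ξ ∈ dualGrading gV j, ∀ u : V,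
      πs x ξ u = gsign K (i * j) * ξ (π (α.symm x) (β.symm (β.symm u)))) :
    IsRep g m α.toLinearMap (dualGrading gV) πs (β.symm.toLinearMap.dualMap) := by
  obtain ⟨⟨hev, hαe, -, -⟩, hmul⟩ := hJ
  obtain ⟨hπe, hβe, hi, hii, hiii⟩ := hrep
  have hαs := symm_even g hg α hαe
  have hβs := symm_even gV hgV β hβe
  replace hαe : ∀ i : ZMod 2, ∀ x ∈ g i, α x ∈ g i := hαe
  simp only [LinearEquiv.coe_coe, IsMult] at hmul hi hii hiii hβe
  have hb : ∀ x u, β.symm (π x u) = π (α.symm x) (β.symm u) := by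
    intro x u
    rw [LinearEquiv.symm_apply_eq]
    have := LinearMap.congr_fun (hi (α.symm x)) (β.symm u)
    simpa using this.symm
  have hms : ∀ x y, α.symm (m x y) = m (α.symm x) (α.symm y) := by
    intro x y
    rw [LinearEquiv.symm_apply_eq, hmul]; simp
  have hBe : ∀ i : ZMod 2, ∀ ξ ∈ dualGrading gV i,
      β.symm.toLinearMap.dualMap ξ ∈ dualGrading gV i := by
    intro i ξ hξ v hv
    exact hξ _ (hβs _ _ hv)
  have hE : EvenRepMap g (dualGrading gV) πs := by
    intro i j x hx ξ hξ u hu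
    rw [hπs i j x hx ξ hξ]
    have h1 := hπe i _ _ (hαs i x hx) _ (hβs _ _ (hβs _ _ hu))
    have h2 : i + (i + j + 1) = j + 1 := (by decide : ∀ i j : ZMod 2, i + (i + j + 1) = j + 1) i j
    rw [h2] at h1
    rw [hξ _ h1, mul_zero]
  have two : ∀ p q j : ZMod 2, ∀ a ∈ g p, ∀ b ∈ g q, ∀ ξ ∈ dualGrading gV j, ∀ u,
      (πs a * πs b * β.symm.toLinearMap.dualMap : Module.End K (Module.Dual K V)) ξ u
        = gsign K (p * (q + j) + q * j) * ξ (π (α.symm (α.symm b))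
          (π (α.symm (α.symm (α.symm (α.symm a))))
            (β.symm (β.symm (β.symm (β.symm (β.symm u))))))) := by
    intro p q j a ha b hb' ξ hξ u
    simp only [Module.End.mul_apply]
    rw [hπs p (q + j) a ha _ (hE _ _ _ hb' _ (hBe _ _ hξ)), hπs q j b hb' _ (hBe _ _ hξ),
      ← mul_assoc, gsign_add']
    simp [hb]
  have three : ∀ p q r j : ZMod 2, ∀ a ∈ g p, ∀ b ∈ g q, ∀ c ∈ g r,
      ∀ ξ ∈ dualGrading gV j, ∀ u,
      (πs a * πs b * πs c : Module.End K (Module.Dual K V)) ξ u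
        = gsign K (p * (q + (r + j)) + q * (r + j) + r * j) * ξ (π (α.symm c)
          (π (α.symm (α.symm (α.symm b))) (π (α.symm (α.symm (α.symm (α.symm (α.symm a)))))
            (β.symm (β.symm (β.symm (β.symm (β.symm (β.symm u))))))))) := by
    intro p q r j a ha b hb' c hc ξ hξ u
    simp only [Module.End.mul_apply]
    have h1 := hE _ _ _ hc _ hξ
    rw [hπs p (q + (r + j)) a ha _ (hE _ _ _ hb' _ h1), hπs q (r + j) b hb' _ h1,
      hπs r j c hc _ hξ, ← mul_assoc, ← mul_assoc, gsign_add', gsign_add']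
    simp [hb]
  have one : ∀ p j : ZMod 2, ∀ a ∈ g p, ∀ ξ ∈ dualGrading gV j, ∀ u,
      (πs a * (β.symm.toLinearMap.dualMap * β.symm.toLinearMap.dualMap) :
        Module.End K (Module.Dual K V)) ξ u
        = gsign K (p * j) * ξ (π (α.symm (α.symm (α.symm a)))
            (β.symm (β.symm (β.symm (β.symm u))))) := by
    intro p j a ha ξ hξ u
    simp only [Module.End.mul_apply]
    rw [hπs p j a ha _ (hBe _ _ (hBe _ _ hξ))]
    simp [hb]
  have lift3 : ∀ i : ZMod 2, ∀ x ∈ g i, ∃ x' ∈ g i, x = α (α (α x')) := fun i x hx =>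
    ⟨_, hαs _ _ (hαs _ _ (hαs _ _ hx)), by simp⟩
  refine ⟨hE, hBe, ?_, ?_, ?_⟩
  · have hom : ∀ i : ZMod 2, ∀ x ∈ g i, β.symm.toLinearMap.dualMap * πs x
        = πs (α x) * β.symm.toLinearMap.dualMap := by
      intro i x hx
      apply dual_ext gV hgV
      intro j ξ hξ u
      simp only [Module.End.mul_apply]
      rw [hπs i j _ (hαe _ _ hx) _ (hBe _ _ hξ)]
      simp only [LinearMap.dualMap_apply, LinearEquiv.coe_coe]
      rw [hπs i j x hx ξ hξ]
      simp [hb]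
    intro x
    obtain ⟨a, ha, b, hb', rfl⟩ := Submodule.mem_sup.1
      (show x ∈ g 0 ⊔ g (0 + 1) by rw [(isCompl_grading g hg 0).sup_eq_top]; trivial)
    simp only [LinearEquiv.coe_coe, map_add, mul_add, add_mul, hom _ _ ha, hom _ _ hb']
  · intro px py pz x hx y hy z hz
    simp only [LinearEquiv.coe_coe]
    apply dual_ext gV hgV
    intro j ξ hξ u
    simp only [LinearMap.add_apply, LinearMap.smul_apply, smul_eq_mul]
    rw [two _ _ j _ (hev _ _ _ (hαe _ _ hx) _ (hαe _ _ hy)) _ (hαe _ _ hz) ξ hξ,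
      two _ _ j _ (hev _ _ _ (hαe _ _ hy) _ (hαe _ _ hz)) _ (hαe _ _ hx) ξ hξ,
      two _ _ j _ (hev _ _ _ (hαe _ _ hz) _ (hαe _ _ hx)) _ (hαe _ _ hy) ξ hξ,
      two _ _ j _ (hαe _ _ (hαe _ _ hx)) _ (hev _ _ _ hy _ hz) ξ hξ,
      two _ _ j _ (hαe _ _ (hαe _ _ hy)) _ (hev _ _ _ hz _ hx) ξ hξ,
      two _ _ j _ (hαe _ _ (hαe _ _ hz)) _ (hev _ _ _ hx _ hy) ξ hξ]
    obtain ⟨x, hx', rfl⟩ := lift3 _ _ hx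
    obtain ⟨y, hy', rfl⟩ := lift3 _ _ hy
    obtain ⟨z, hz', rfl⟩ := lift3 _ _ hz
    have h := congrArg ξ (LinearMap.congr_fun (hii px py pz x hx' y hy' z hz')
      (β.symm (β.symm (β.symm (β.symm (β.symm (β.symm u)))))))
    simp only [LinearMap.add_apply, LinearMap.smul_apply, smul_eq_mul, map_add, map_smul,
      Module.End.mul_apply, LinearEquiv.coe_coe, LinearEquiv.apply_symm_apply] at h
    have s0 := sgn4 (K := K) (fun px py pz j => (px * pz, (px + py) * (pz + j) + (pz) * j, py * pz)) (by decide) px py pz j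
    have s1 := sgn4 (K := K) (fun px py pz j => (px * py, (py + pz) * (px + j) + (px) * j, px * pz)) (by decide) px py pz j
    have s2 := sgn4 (K := K) (fun px py pz j => (py * pz, (pz + px) * (py + j) + (py) * j, px * py)) (by decide) px py pz j
    have s3 := sgn4 (K := K) (fun px py pz j => (px * pz, (px) * ((py + pz) + j) + ((py + pz)) * j, px * py)) (by decide) px py pz j
    have s4 := sgn4 (K := K) (fun px py pz j => (px * py, (py) * ((pz + px) + j) + ((pz + px)) * j, py * pz)) (by decide) px py pz j
    have s5 := sgn4 (K := K) (fun px py pz j => (py * pz, (pz) * ((px + py) + j) + ((px + py)) * j, px * pz)) (by decide) px py pz j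
    simp only at s0 s1 s2 s3 s4 s5
    simp only [hms, LinearEquiv.symm_apply_apply, ← mul_assoc, s0, s1, s2, s3, s4, s5]
    linear_combination -gsign K (j * (px + py + pz)) * h
  · intro px py pz x hx y hy z hz
    simp only [LinearEquiv.coe_coe]
    apply dual_ext gV hgV
    intro j ξ hξ u
    simp only [LinearMap.add_apply, LinearMap.smul_apply, smul_eq_mul]
    rw [two _ _ j _ (hev _ _ _ (hαe _ _ hx) _ (hαe _ _ hy)) _ (hαe _ _ hz) ξ hξ,
      two _ _ j _ (hev _ _ _ (hαe _ _ hy) _ (hαe _ _ hz)) _ (hαe _ _ hx) ξ hξ,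
      two _ _ j _ (hev _ _ _ (hαe _ _ hz) _ (hαe _ _ hx)) _ (hαe _ _ hy) ξ hξ,
      three _ _ _ j _ (hαe _ _ (hαe _ _ hx)) _ (hαe _ _ hy) _ hz ξ hξ,
      three _ _ _ j _ (hαe _ _ (hαe _ _ hz)) _ (hαe _ _ hy) _ hx ξ hξ,
      one _ j _ (hev _ _ _ (hev _ _ _ hx _ hz) _ (hαe _ _ hy)) ξ hξ]
    obtain ⟨x, hx', rfl⟩ := lift3 _ _ hx
    obtain ⟨y, hy', rfl⟩ := lift3 _ _ hy
    obtain ⟨z, hz', rfl⟩ := lift3 _ _ hz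
    have h := congrArg ξ (LinearMap.congr_fun
      ((hii px py pz x hx' y hy' z hz').symm.trans (hiii px py pz x hx' y hy' z hz'))
      (β.symm (β.symm (β.symm (β.symm (β.symm (β.symm u)))))))
    simp only [LinearMap.add_apply, LinearMap.smul_apply, smul_eq_mul, map_add, map_smul,
      Module.End.mul_apply, LinearEquiv.coe_coe, LinearEquiv.apply_symm_apply] at h
    have s0 := sgn4 (K := K) (fun px py pz j => (px * pz, (px + py) * (pz + j) + (pz) * j, py * pz)) (by decide) px py pz j
    have s1 := sgn4 (K := K) (fun px py pz j => (px * py, (py + pz) * (px + j) + (px) * j, px * pz)) (by decide) px py pz j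
    have s2 := sgn4 (K := K) (fun px py pz j => (py * pz, (pz + px) * (py + j) + (py) * j, px * py)) (by decide) px py pz j
    have s3 := sgn4 (K := K) (fun px py pz j => (px * pz, px * (py + (pz + j)) + py * (pz + j) + pz * j, px * py + py * pz)) (by decide) px py pz j
    have s4 := sgn4 (K := K) (fun px py pz j => (px * py + py * pz, pz * (py + (px + j)) + py * (px + j) + px * j, px * pz)) (by decide) px py pz j
    have s5 := sgn4 (K := K) (fun px py pz j => (py * pz + px * pz, (px + pz + py) * j, py * pz + px * pz)) (by decide) px py pz j
    simp only at s0 s1 s2 s3 s4 s5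
    simp only [hms, LinearEquiv.symm_apply_apply, ← mul_assoc, s0, s1, s2, s3, s4, s5]
    linear_combination gsign K (j * (px + py + pz)) * h
end
end

section
/- Let (V, π, β) be a representation of a multiplicative Hom-Jordan superalgebra (J, ·, α). An even linear map T : V → J is an O-operator associated to (V, π, β) if and only if the map N_T : J ⊕ V → J ⊕ V given by N_T(x + u) = −T(u) is a Nijenhuis operator on the semi-direct product Hom-Jordan superalgebra J ⋉ V. -/
open scoped TensorProduct

noncomputable section

variable {K : Type*} [Field K] [CharZero K]
variable {J V : Type*} [AddCommGroup J] [Module K J] [AddCommGroup V] [Module K V]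

/-- an even linear map `T : V → J` is an O-operator associated to
`(V, π, β)` iff `N_T(x + u) = −T(u)` is a Nijenhuis operator on the semi-direct
product Hom-Jordan superalgebra `J ⋉ V`. -/
theorem oOperator_iff_nijenhuis (g : ZMod 2 → Submodule K J)
    (hg : DirectSum.IsInternal g)
    (m : J →ₗ[K] J →ₗ[K] J) (α : J →ₗ[K] J) (hJ : IsMultHomJordan g m α)
    (gV : ZMod 2 → Submodule K V) (hgV : DirectSum.IsInternal gV)
    (π : J →ₗ[K] Module.End K V) (β : Module.End K V)
    (hrep : IsRep g m α gV π β)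
    (m' : (J × V) →ₗ[K] (J × V) →ₗ[K] (J × V))
    (hm' : IsSemidirectMul g gV m π m')
    (T : V →ₗ[K] J) (hTe : ∀ i : ZMod 2, ∀ v ∈ gV i, T v ∈ g i) :
    IsOOperator g m α gV π β T ↔
      IsNijenhuis (prodGrading g gV) m' (α.prodMap β)
        (LinearMap.prod (-(T ∘ₗ LinearMap.snd K J V)) 0) := by
  have hspan : ∀ P : J × V → Prop, (∀ a b, P a → P b → P (a + b)) →
      (∀ i : ZMod 2, ∀ x ∈ g i, ∀ u ∈ gV i, P (x, u)) → ∀ a, P a := by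
    intro P hadd hhom a
    have h1 : ∀ x : J, P (x, 0) := by
      intro x
      have hx : x ∈ iSup g := by rw [hg.submodule_iSup_eq_top]; trivial
      refine Submodule.iSup_induction g (motive := fun x => P (x, 0)) hx
        (fun i x hx => hhom i x hx 0 (zero_mem _)) (hhom 0 0 (zero_mem _) 0 (zero_mem _)) ?_
      intro x y hx hy
      simpa using hadd _ _ hx hy
    have h2 : ∀ u : V, P (0, u) := by
      intro u
      have hu : u ∈ iSup gV := by rw [hgV.submodule_iSup_eq_top]; trivial
      refine Submodule.iSup_induction gV (motive := fun u => P (0, u)) hu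
        (fun i u hu => hhom i 0 (zero_mem _) u hu) (hhom 0 0 (zero_mem _) 0 (zero_mem _)) ?_
      intro x y hx hy
      simpa using hadd _ _ hx hy
    have := hadd _ _ (h1 a.1) (h2 a.2)
    simpa using this
  have key : ∀ i j : ZMod 2, ∀ x ∈ g i, ∀ u ∈ gV i, ∀ y ∈ g j, ∀ v ∈ gV j,
      ((m' ((LinearMap.prod (-(T ∘ₗ LinearMap.snd K J V)) 0 : J × V →ₗ[K] J × V) (x, u))
          ((LinearMap.prod (-(T ∘ₗ LinearMap.snd K J V)) 0 : J × V →ₗ[K] J × V) (y, v)) =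
        (LinearMap.prod (-(T ∘ₗ LinearMap.snd K J V)) 0 : J × V →ₗ[K] J × V)
          (m' ((LinearMap.prod (-(T ∘ₗ LinearMap.snd K J V)) 0 : J × V →ₗ[K] J × V) (x, u)) (y, v)
          + m' (x, u) ((LinearMap.prod (-(T ∘ₗ LinearMap.snd K J V)) 0 : J × V →ₗ[K] J × V) (y, v))
          - (LinearMap.prod (-(T ∘ₗ LinearMap.snd K J V)) 0 : J × V →ₗ[K] J × V)
            (m' (x, u) (y, v)))) ↔
      m (T u) (T v) = T (π (T u) v + gsign K (i * j) • π (T v) u)) := by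
    intro i j x hx u hu y hy v hv
    have e : ∀ (x : J) (u : V),
        (LinearMap.prod (-(T ∘ₗ LinearMap.snd K J V)) 0 : J × V →ₗ[K] J × V) (x, u)
          = (-T u, 0) := by
      intro x u; simp
    have hu' := neg_mem (hTe i u hu)
    have hv' := neg_mem (hTe j v hv)
    rw [e, e, hm' i j _ hu' 0 (zero_mem _) _ hv' 0 (zero_mem _),
      hm' i j _ hu' 0 (zero_mem _) _ hy _ hv, hm' i j _ hx _ hu _ hv' 0 (zero_mem _),
      hm' i j _ hx _ hu _ hy _ hv, e]
    simp only [Prod.mk_add_mk, Prod.mk_sub_mk]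
    rw [e]
    simp [add_comm]
  constructor
  · rintro ⟨-, h2, h3⟩
    refine ⟨?_, ?_, ?_⟩
    · rintro i ⟨x, u⟩ ⟨-, hu⟩
      exact ⟨by simpa using hTe i u hu, by simp⟩
    · apply LinearMap.ext
      rintro ⟨x, u⟩
      simp [h2]
    · refine hspan _ ?_ ?_
      · intro a b ha hb y
        simp only [map_add, LinearMap.add_apply, map_sub] at ha hb ⊢
        rw [ha, hb]; abel
      · intro i x hx u hu
        refine hspan _ ?_ ?_
        · intro a b ha hb
          simp only [map_add, map_sub] at ha hb ⊢
          rw [ha, hb]; abel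
        · intro j y hy v hv
          exact (key i j x hx u hu y hy v hv).2 (h3 i j u hu v hv)
  · rintro ⟨-, h2, h3⟩
    refine ⟨hTe, ?_, ?_⟩
    · intro v
      have := congrArg Prod.fst (LinearMap.congr_fun h2 (0, v))
      simpa using this.symm
    · intro i j u hu v hv
      exact (key i j 0 (zero_mem _) u hu 0 (zero_mem _) v hv).1 (h3 _ _)
end
end
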